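/- arXiv:2311.01585 — 2 statements merged into one kernel-verified Lean document; each statement's English description precedes it below -/
import Mathlib

section
/- Let p ≥ 1 be a real number. For compact sets K, L ⊆ ℝⁿ, the Lipschitz p-capacity is strongly subadditive: cap_p(K ∪ L) + cap_p(K ∩ L) ≤ cap_p(K) + cap_p(L). -/
open MeasureTheory
open scoped ENNReal

/-- The class `W(K)` of Lipschitz functions with compact support that are `≥ 1` on `K`. -/
def lipTestClass {n : ℕ} (K : Set (EuclideanSpace ℝ (Fin n))) :
    Set (EuclideanSpace ℝ (Fin n) → ℝ) :=
  {u | (∃ L : NNReal, LipschitzWith L u) ∧ HasCompactSupport u ∧ ∀ x ∈ K, 1 ≤ u x}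

/-- The Lipschitz `p`-capacity: `cap_p(K) = inf { ∫ ‖∇u‖^p : u ∈ W(K) }` (`inf ∅ = ∞`),
where `∇u` is the a.e.-defined gradient of the Lipschitz function `u`. -/
noncomputable def lipCap {n : ℕ} (p : ℝ) (K : Set (EuclideanSpace ℝ (Fin n))) : ℝ≥0∞ :=
  ⨅ u ∈ lipTestClass K, ∫⁻ x, ENNReal.ofReal (‖gradient u x‖ ^ p)

theorem fderiv_eq_of_le_of_eq {E : Type*} [NormedAddCommGroup E] [NormedSpace ℝ E]
    {f g : E → ℝ} {x : E} (hf : DifferentiableAt ℝ f x) (hg : DifferentiableAt ℝ g x)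
    (hle : f ≤ g) (heq : f x = g x) : fderiv ℝ f x = fderiv ℝ g x := by
  have hmin : IsLocalMin (g - f) x :=
    Filter.Eventually.of_forall fun y => by simpa [heq] using hle y
  have h := hmin.fderiv_eq_zero
  rw [fderiv_sub hg hf, sub_eq_zero] at h
  exact h.symm

theorem gradient_sup_inf_cases {E : Type*} [NormedAddCommGroup E] [InnerProductSpace ℝ E]
    [CompleteSpace E] {u v : E → ℝ} {x : E} (hu : DifferentiableAt ℝ u x)
    (hv : DifferentiableAt ℝ v x) (hsup : DifferentiableAt ℝ (u ⊔ v) x)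
    (hinf : DifferentiableAt ℝ (u ⊓ v) x) :
    (gradient (u ⊔ v) x = gradient u x ∧ gradient (u ⊓ v) x = gradient v x) ∨
      (gradient (u ⊔ v) x = gradient v x ∧ gradient (u ⊓ v) x = gradient u x) := by
  unfold gradient
  rcases lt_trichotomy (u x) (v x) with h | h | h
  · right
    have hev := hu.continuousAt.eventually_lt hv.continuousAt h
    have h1 : u ⊔ v =ᶠ[nhds x] v := hev.mono fun y hy => sup_of_le_right hy.le
    have h2 : u ⊓ v =ᶠ[nhds x] u := hev.mono fun y hy => inf_of_le_left hy.le
    rw [h1.fderiv_eq, h2.fderiv_eq]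
    exact ⟨rfl, rfl⟩
  · left
    rw [fderiv_eq_of_le_of_eq hu hsup le_sup_left (by simp [h]),
      fderiv_eq_of_le_of_eq hinf hv inf_le_right (by simp [h])]
    exact ⟨rfl, rfl⟩
  · left
    have hev := hv.continuousAt.eventually_lt hu.continuousAt h
    have h1 : u ⊔ v =ᶠ[nhds x] u := hev.mono fun y hy => sup_of_le_left hy.le
    have h2 : u ⊓ v =ᶠ[nhds x] v := hev.mono fun y hy => inf_of_le_right hy.le
    rw [h1.fderiv_eq, h2.fderiv_eq]
    exact ⟨rfl, rfl⟩

theorem sup_mem_lipTestClass {n : ℕ} {K L : Set (EuclideanSpace ℝ (Fin n))}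
    {u v : EuclideanSpace ℝ (Fin n) → ℝ} (hu : u ∈ lipTestClass K) (hv : v ∈ lipTestClass L) :
    u ⊔ v ∈ lipTestClass (K ∪ L) := by
  obtain ⟨⟨A, hA⟩, hcu, h1u⟩ := hu
  obtain ⟨⟨B, hB⟩, hcv, h1v⟩ := hv
  refine ⟨⟨_, hA.max hB⟩, hcu.comp₂_left hcv (m := max) (max_self 0), ?_⟩
  rintro x (hx | hx)
  · exact le_sup_of_le_left (h1u x hx)
  · exact le_sup_of_le_right (h1v x hx)

theorem inf_mem_lipTestClass {n : ℕ} {K L : Set (EuclideanSpace ℝ (Fin n))}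
    {u v : EuclideanSpace ℝ (Fin n) → ℝ} (hu : u ∈ lipTestClass K) (hv : v ∈ lipTestClass L) :
    u ⊓ v ∈ lipTestClass (K ∩ L) := by
  obtain ⟨⟨A, hA⟩, hcu, h1u⟩ := hu
  obtain ⟨⟨B, hB⟩, hcv, h1v⟩ := hv
  exact ⟨⟨_, hA.min hB⟩, hcu.comp₂_left hcv (m := min) (min_self 0),
    fun x hx => le_inf (h1u x hx.1) (h1v x hx.2)⟩

theorem measurable_gradient {E : Type*} [NormedAddCommGroup E] [InnerProductSpace ℝ E]
    [CompleteSpace E] [MeasurableSpace E] [BorelSpace E] (u : E → ℝ) :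
    Measurable (gradient u) := by
  borelize (StrongDual ℝ E)
  exact (InnerProductSpace.toDual ℝ E).symm.continuous.measurable.comp (measurable_fderiv ℝ u)

theorem lintegral_gradient_sup_add_inf {n : ℕ} (p : ℝ) {u v : EuclideanSpace ℝ (Fin n) → ℝ}
    {A B : NNReal} (hu : LipschitzWith A u) (hv : LipschitzWith B v) :
    (∫⁻ x, ENNReal.ofReal (‖gradient (u ⊔ v) x‖ ^ p)) +
        ∫⁻ x, ENNReal.ofReal (‖gradient (u ⊓ v) x‖ ^ p) =
      (∫⁻ x, ENNReal.ofReal (‖gradient u x‖ ^ p)) +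
        ∫⁻ x, ENNReal.ofReal (‖gradient v x‖ ^ p) := by
  have hmeas (w : EuclideanSpace ℝ (Fin n) → ℝ) :
      Measurable fun x => ENNReal.ofReal (‖gradient w x‖ ^ p) :=
    ((measurable_gradient w).norm.pow_const p).ennreal_ofReal
  rw [← lintegral_add_left (hmeas _), ← lintegral_add_left (hmeas _)]
  have hsup : LipschitzWith (max A B) (u ⊔ v) := hu.max hv
  have hinf : LipschitzWith (max A B) (u ⊓ v) := hu.min hv
  refine lintegral_congr_ae ?_
  filter_upwards [hu.ae_differentiableAt, hv.ae_differentiableAt, hsup.ae_differentiableAt,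
    hinf.ae_differentiableAt] with x hxu hxv hxs hxi
  rcases gradient_sup_inf_cases hxu hxv hxs hxi with ⟨h1, h2⟩ | ⟨h1, h2⟩
  · rw [h1, h2]
  · rw [h1, h2, add_comm]

/-- Theorem 3.11(1): the Lipschitz `p`-capacity is strongly subadditive on compact sets:
`cap_p(K ∪ L) + cap_p(K ∩ L) ≤ cap_p(K) + cap_p(L)`. -/
theorem stmt9 {n : ℕ} (p : ℝ) (hp : 1 ≤ p)
    (K L : Set (EuclideanSpace ℝ (Fin n))) (hK : IsCompact K) (hL : IsCompact L) :
    lipCap p (K ∪ L) + lipCap p (K ∩ L) ≤ lipCap p K + lipCap p L := by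
  conv_rhs => unfold lipCap
  simp only [ENNReal.iInf_add, ENNReal.add_iInf]
  refine le_iInf₂ fun v hv => le_iInf₂ fun u hu => ?_
  obtain ⟨A, hA⟩ := hu.1
  obtain ⟨B, hB⟩ := hv.1
  rw [← lintegral_gradient_sup_add_inf p hA hB]
  exact add_le_add (iInf₂_le _ (sup_mem_lipTestClass hu hv))
    (iInf₂_le _ (inf_mem_lipTestClass hu hv))
end

section
/- Let Ω ⊆ ℝⁿ be open, p ≥ 2 a real number, 0 < α ≤ β, and G : Ω → ℝ^{n×n} a measurable field of symmetric matrices with α‖ξ‖² ≤ ⟨G(x)ξ, ξ⟩ ≤ β‖ξ‖² for all x ∈ Ω and ξ ∈ ℝⁿ. Let u : Ω → ℝ be continuously differentiable with ∫_Ω ⟨G∇u, ∇u⟩^{(p−2)/2} ⟨G∇u, ∇η⟩ dx = 0 for every continuously differentiable η : Ω → ℝ with compact support in Ω. Then for every continuously differentiable φ : Ω → ℝ with φ ≥ 0 and compact support in Ω, and every c ∈ ℝ: (∫_Ω φ^p ‖∇u‖^p dx)^{1/p} ≤ p·√(β/α) · (∫_Ω ‖∇φ‖^p |u − c|^p dx)^{1/p}.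 -/
open scoped RealInnerProductSpace
open MeasureTheory

section FiniteMeasure

variable {X : Type*} [MeasurableSpace X] {μ : Measure X} [IsFiniteMeasure μ]

theorem memLp_rpow_of_ae_le {f : X → ℝ} (hf : AEMeasurable f μ) (hf0 : ∀ x, 0 ≤ f x)
    {M : ℝ} (hM : ∀ᵐ x ∂μ, f x ≤ M) {r : ℝ} (hr : 0 ≤ r) (q : ENNReal) :
    MemLp (fun x => f x ^ r) q μ := by
  refine MemLp.of_bound (hf.pow_const r).aestronglyMeasurable (M ^ r) ?_
  filter_upwards [hM] with x hx
  rw [Real.norm_of_nonneg (Real.rpow_nonneg (hf0 x) r)]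
  exact Real.rpow_le_rpow (hf0 x) hx hr

theorem integral_rpow_rpow_inv_le_mul {p : ℝ} (hp : 0 < p) {f g : X → ℝ}
    (hf0 : ∀ x, 0 ≤ f x) (hg0 : ∀ x, 0 ≤ g x) (hg : AEMeasurable g μ)
    {M : ℝ} (hM : ∀ᵐ x ∂μ, g x ≤ M) {C : ℝ} (hC : 0 ≤ C) (hfg : ∀ᵐ x ∂μ, f x ≤ C * g x) :
    (∫ x, f x ^ p ∂μ) ^ (1 / p) ≤ C * (∫ x, g x ^ p ∂μ) ^ (1 / p) := by
  have hgp : Integrable (fun x => g x ^ p) μ :=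
    memLp_one_iff_integrable.1 (memLp_rpow_of_ae_le hg hg0 hM hp.le 1)
  have h : ∫ x, f x ^ p ∂μ ≤ C ^ p * ∫ x, g x ^ p ∂μ := by
    rw [← integral_const_mul]
    refine integral_mono_of_nonneg (.of_forall fun x => Real.rpow_nonneg (hf0 x) p)
      (hgp.const_mul _) ?_
    filter_upwards [hfg] with x hx
    rw [← Real.mul_rpow hC (hg0 x)]
    exact Real.rpow_le_rpow (hf0 x) hx hp.le
  have hI : 0 ≤ ∫ x, g x ^ p ∂μ := integral_nonneg fun x => Real.rpow_nonneg (hg0 x) p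
  calc (∫ x, f x ^ p ∂μ) ^ (1 / p) ≤ (C ^ p * ∫ x, g x ^ p ∂μ) ^ (1 / p) :=
        Real.rpow_le_rpow (integral_nonneg fun x => Real.rpow_nonneg (hf0 x) p) h (by positivity)
    _ = C * (∫ x, g x ^ p ∂μ) ^ (1 / p) := by
        rw [Real.mul_rpow (by positivity) hI, ← Real.rpow_mul hC, mul_one_div_cancel hp.ne',
          Real.rpow_one]

/-- If `F` has vanishing integral and differs from `f ^ p` by at most `p * f ^ (p - 1) * g`,
then the `L^p` norm of `f` is at most `p` times that of `g`. -/
theorem integral_rpow_rpow_inv_le_of_abs_sub_le {p : ℝ} (hp : 1 < p) {f g F : X → ℝ}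
    (hf : AEMeasurable f μ) (hg : AEMeasurable g μ) (hF : AEMeasurable F μ)
    (hf0 : ∀ x, 0 ≤ f x) (hg0 : ∀ x, 0 ≤ g x) {M N : ℝ} (hM : ∀ᵐ x ∂μ, f x ≤ M)
    (hN : ∀ᵐ x ∂μ, g x ≤ N) (hF0 : ∫ x, F x ∂μ = 0)
    (hFf : ∀ᵐ x ∂μ, |F x - f x ^ p| ≤ p * (f x ^ (p - 1) * g x)) :
    (∫ x, f x ^ p ∂μ) ^ (1 / p) ≤ p * (∫ x, g x ^ p ∂μ) ^ (1 / p) := by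
  have hp0 : 0 < p := by linarith
  have hpq := (Real.HolderConjugate.conjExponent hp).symm
  set q := Real.conjExponent p with hq
  have hf1 : ∀ x, 0 ≤ f x ^ (p - 1) := fun x => Real.rpow_nonneg (hf0 x) _
  have hfL := fun q => memLp_rpow_of_ae_le hf hf0 hM (r := p - 1) (by linarith) q
  have hgL : ∀ q, MemLp g q μ := fun q => by
    simpa using memLp_rpow_of_ae_le hg hg0 hN (r := 1) zero_le_one q
  have hfp : Integrable (fun x => f x ^ p) μ :=
    memLp_one_iff_integrable.1 (memLp_rpow_of_ae_le hf hf0 hM hp0.le 1)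
  have hfg : Integrable (fun x => f x ^ (p - 1) * g x) μ :=
    (hfL 2).integrable_mul (hgL 2)
  have hFi : Integrable F μ := by
    have h : Integrable (fun x => F x - f x ^ p) μ :=
      (hfg.const_mul p).mono' (hF.sub (hf.pow_const p)).aestronglyMeasurable hFf
    refine (h.add hfp).congr (.of_forall fun x => ?_)
    simp
  have h1 : ∫ x, f x ^ p ∂μ ≤ p * ∫ x, f x ^ (p - 1) * g x ∂μ := by
    have h : ∫ x, f x ^ p - F x ∂μ ≤ ∫ x, p * (f x ^ (p - 1) * g x) ∂μ := by
      refine integral_mono_ae (hfp.sub hFi) (hfg.const_mul p) ?_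
      filter_upwards [hFf] with x hx
      linarith [(abs_le.1 hx).1]
    rwa [integral_sub hfp hFi, hF0, sub_zero, integral_const_mul] at h
  have h2 := integral_mul_le_Lp_mul_Lq_of_nonneg hpq (.of_forall hf1) (.of_forall hg0)
    (hfL _) (hgL _)
  have hq' : (p - 1) * q = p := by
    rw [hq, Real.conjExponent]
    field_simp [sub_ne_zero.2 hp.ne']
  have h3 : ∀ x, (f x ^ (p - 1)) ^ q = f x ^ p := fun x => by
    rw [← Real.rpow_mul (hf0 x), hq']
  simp only [h3] at h2
  set A := ∫ x, f x ^ p ∂μ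
  set B := (∫ x, g x ^ p ∂μ) ^ (1 / p) with hB
  have hB0 : 0 ≤ B := by
    refine Real.rpow_nonneg (integral_nonneg fun x => Real.rpow_nonneg (hg0 x) p) _
  have hA0 : 0 ≤ A := integral_nonneg fun x => Real.rpow_nonneg (hf0 x) p
  rcases hA0.eq_or_lt with hA | hA
  · rw [← hA, Real.zero_rpow (by positivity)]
    positivity
  · have hAq : 0 < A ^ (1 / q) := Real.rpow_pos_of_pos hA _
    have h4 : A ^ (1 / q) * A ^ (1 / p) = A := by
      rw [← Real.rpow_add hA, one_div, one_div, hpq.inv_add_inv_eq_one, Real.rpow_one]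
    refine le_of_mul_le_mul_left ?_ hAq
    calc A ^ (1 / q) * A ^ (1 / p) = A := h4
      _ ≤ p * (A ^ (1 / q) * B) := h1.trans (mul_le_mul_of_nonneg_left h2 hp0.le)
      _ = A ^ (1 / q) * (p * B) := by ring

end FiniteMeasure

section InnerProductSpace

variable {E : Type*} [NormedAddCommGroup E] [InnerProductSpace ℝ E]

theorem LinearMap.abs_inner_le_sqrt_mul_sqrt {T : E →ₗ[ℝ] E}
    (hsymm : ∀ ξ η : E, ⟪T ξ, η⟫ = ⟪ξ, T η⟫) (hpos : ∀ ξ : E, 0 ≤ ⟪T ξ, ξ⟫) (ξ η : E) :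
    |⟪T ξ, η⟫| ≤ √⟪T ξ, ξ⟫ * √⟪T η, η⟫ := by
  rw [← Real.sqrt_mul (hpos ξ)]
  refine Real.abs_le_sqrt ?_
  have h := LinearMap.BilinForm.apply_sq_le_of_symm ((innerₗ E).comp T) hpos
    ⟨fun x y => by simp [hsymm x y, real_inner_comm]⟩ ξ η
  simpa using h

variable [CompleteSpace E]

theorem measurable_gradient_s16 [MeasurableSpace E] [BorelSpace E] (f : E → ℝ) :
    Measurable (gradient f) :=
  (InnerProductSpace.toDual ℝ E).symm.continuous.measurable.comp (measurable_fderiv ℝ f)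

theorem ContDiffOn.continuousOn_gradient {f : E → ℝ} {s : Set E} (hf : ContDiffOn ℝ 1 f s)
    (hs : IsOpen s) : ContinuousOn (gradient f) s :=
  (InnerProductSpace.toDual ℝ E).symm.continuous.comp_continuousOn
    (hf.continuousOn_fderiv_of_isOpen hs le_rfl)

theorem gradient_rpow_mul_sub_const {φ u : E → ℝ} {x : E} (hφ : DifferentiableAt ℝ φ x)
    (hu : DifferentiableAt ℝ u x) {p : ℝ} (hp : 1 ≤ p) (c : ℝ) :
    gradient (fun y => φ y ^ p * (u y - c)) x =
      φ x ^ p • gradient u x + (p * φ x ^ (p - 1) * (u x - c)) • gradient φ x := by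
  have h := (hφ.hasFDerivAt.rpow_const (Or.inr hp)).mul (hu.hasFDerivAt.sub_const c)
  refine HasGradientAt.gradient ?_
  rw [hasGradientAt_iff_hasFDerivAt]
  refine h.congr_fderiv ?_
  simp only [map_add, map_smul, toDual_gradient, smul_smul]
  rw [mul_comm (u x - c)]

end InnerProductSpace

theorem Measurable.linearMap_family_apply {X : Type*} [MeasurableSpace X] {n : ℕ} {F : Type*}
    [NormedAddCommGroup F] [NormedSpace ℝ F] [MeasurableSpace F] [BorelSpace F]
    [SecondCountableTopology F]
    {G : X → EuclideanSpace ℝ (Fin n) →ₗ[ℝ] F} (hG : ∀ ξ, Measurable fun x => G x ξ)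
    {v : X → EuclideanSpace ℝ (Fin n)} (hv : Measurable v) : Measurable fun x => G x (v x) := by
  have h : (fun x => G x (v x)) =
      fun x => ∑ i, v x i • G x (EuclideanSpace.basisFun (Fin n) ℝ i) := by
    ext x
    conv_lhs => rw [← (EuclideanSpace.basisFun (Fin n) ℝ).sum_repr (v x)]
    simp [map_sum]
  rw [h]
  refine Finset.measurable_sum _ fun i _ => Measurable.smul ?_ (hG _)
  fun_prop

theorem ContDiffOn.contDiff_rpow_mul_sub_const {E : Type*} [NormedAddCommGroup E]
    [NormedSpace ℝ E] {Ω : Set E} (hΩ : IsOpen Ω) {φ u : E → ℝ} (hu : ContDiffOn ℝ 1 u Ω)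
    (hφ : ContDiff ℝ 1 φ) (hφΩ : tsupport φ ⊆ Ω) {p : ℝ} (hp : 1 ≤ p) (c : ℝ) :
    ContDiff ℝ 1 fun x => φ x ^ p * (u x - c) := by
  rw [contDiff_iff_contDiffAt]
  intro x
  by_cases hx : x ∈ tsupport φ
  · exact (hφ.rpow_const_of_le (by simpa using hp)).contDiffAt.mul
      ((hu.contDiffAt (hΩ.mem_nhds (hφΩ hx))).sub contDiffAt_const)
  · refine (contDiffAt_const (c := (0 : ℝ))).congr_of_eventuallyEq ?_
    filter_upwards [notMem_tsupport_iff_eventuallyEq.1 hx] with y hy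
    simp [hy, Real.zero_rpow (by linarith : p ≠ 0)]


/-- Caccioppoli type inequality (5.1) for 𝒜-harmonic functions of a uniformly elliptic
symmetric measurable matrix field `G` with `α‖ξ‖² ≤ ⟨Gξ, ξ⟩ ≤ β‖ξ‖²`: if `u` is `C¹` on the
open set `Ω` and `∫_Ω ⟨G∇u, ∇u⟩^((p-2)/2) ⟨G∇u, ∇η⟩ = 0` for all `C¹` test functions `η`
with compact support in `Ω`, then for every nonnegative `C¹` function `φ` with compact
support in `Ω` and every `c ∈ ℝ`,
`(∫_Ω φ^p ‖∇u‖^p)^(1/p) ≤ p √(β/α) (∫_Ω ‖∇φ‖^p |u - c|^p)^(1/p)`. -/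
theorem stmt16 {n : ℕ} (Ω : Set (EuclideanSpace ℝ (Fin n))) (hΩ : IsOpen Ω)
    (p : ℝ) (hp : 2 ≤ p) (α β : ℝ) (hα : 0 < α) (hαβ : α ≤ β)
    (G : EuclideanSpace ℝ (Fin n) →
      EuclideanSpace ℝ (Fin n) →ₗ[ℝ] EuclideanSpace ℝ (Fin n))
    (hGmeas : ∀ ξ : EuclideanSpace ℝ (Fin n), Measurable fun x => G x ξ)
    (hGsymm : ∀ x, x ∈ Ω → ∀ ξ η : EuclideanSpace ℝ (Fin n), ⟪G x ξ, η⟫ = ⟪ξ, G x η⟫)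
    (hGell : ∀ x, x ∈ Ω → ∀ ξ : EuclideanSpace ℝ (Fin n),
      α * ‖ξ‖ ^ 2 ≤ ⟪G x ξ, ξ⟫ ∧ ⟪G x ξ, ξ⟫ ≤ β * ‖ξ‖ ^ 2)
    (u : EuclideanSpace ℝ (Fin n) → ℝ) (hu : ContDiffOn ℝ 1 u Ω)
    (huharm : ∀ η : EuclideanSpace ℝ (Fin n) → ℝ, ContDiff ℝ 1 η → HasCompactSupport η →
      tsupport η ⊆ Ω →
      ∫ x in Ω, ⟪G x (gradient u x), gradient u x⟫ ^ ((p - 2) / 2) *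
        ⟪G x (gradient u x), gradient η x⟫ = 0)
    (φ : EuclideanSpace ℝ (Fin n) → ℝ) (hφ : ContDiff ℝ 1 φ) (hφ0 : ∀ x, 0 ≤ φ x)
    (hφsupp : HasCompactSupport φ) (hφΩ : tsupport φ ⊆ Ω) (c : ℝ) :
    (∫ x in Ω, φ x ^ p * ‖gradient u x‖ ^ p) ^ (1 / p) ≤
      p * Real.sqrt (β / α) *
        (∫ x in Ω, ‖gradient φ x‖ ^ p * |u x - c| ^ p) ^ (1 / p) := by
  have hp1 : 1 < p := by linarith
  have hp0 : 0 < p := by linarith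
  have hβ : 0 < β := hα.trans_le hαβ
  set K := tsupport φ with hK
  have hKc : IsCompact K := hφsupp
  have hKm : MeasurableSet K := hKc.measurableSet
  have hφz : ∀ x, x ∉ K → φ x = 0 := fun x hx => image_eq_zero_of_notMem_tsupport hx
  have hgz : ∀ x, x ∉ K → gradient φ x = 0 := fun x hx => by
    have h : fderiv ℝ φ x = 0 := (HasFDerivAt.of_notMem_tsupport ℝ hx).fderiv
    simp [gradient, h]
  have hrestrict : ∀ F : EuclideanSpace ℝ (Fin n) → ℝ, (∀ x ∈ Ω \ K, F x = 0) →
      ∫ x in Ω, F x = ∫ x in K, F x := fun F hF =>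
    setIntegral_eq_of_subset_of_forall_sdiff_eq_zero hΩ.measurableSet hφΩ hF
  have : IsFiniteMeasure (volume.restrict K) :=
    ⟨by simpa using hKc.measure_lt_top⟩
  have huK : ContinuousOn u K := hu.continuousOn.mono hφΩ
  have hgu : ContinuousOn (gradient u) K := (hu.continuousOn_gradient hΩ).mono hφΩ
  have hgφ : ContinuousOn (gradient φ) K :=
    (hφ.contDiffOn.continuousOn_gradient isOpen_univ).mono (Set.subset_univ K)
  have hum : AEMeasurable u (volume.restrict K) := huK.aemeasurable hKm
  have hφm : Measurable φ := hφ.continuous.measurable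
  have hmu := measurable_gradient_s16 u
  have hmφ := measurable_gradient_s16 φ
  have hsm : Measurable fun x => ⟪G x (gradient u x), gradient u x⟫ :=
    (Measurable.linearMap_family_apply hGmeas hmu).inner hmu
  have htm : Measurable fun x => ⟪G x (gradient φ x), gradient φ x⟫ :=
    (Measurable.linearMap_family_apply hGmeas hmφ).inner hmφ
  have hpos : ∀ x ∈ Ω, ∀ ξ, 0 ≤ ⟪G x ξ, ξ⟫ := fun x hx ξ =>
    le_trans (by positivity) (hGell x hx ξ).1
  have hle : ∀ x ∈ Ω, ∀ ξ, √⟪G x ξ, ξ⟫ ≤ √β * ‖ξ‖ := fun x hx ξ => by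
    refine (Real.sqrt_le_sqrt (hGell x hx ξ).2).trans_eq ?_
    rw [Real.sqrt_mul hβ.le, Real.sqrt_sq (norm_nonneg _)]
  have hge : ∀ x ∈ Ω, ∀ ξ, √α * ‖ξ‖ ≤ √⟪G x ξ, ξ⟫ := fun x hx ξ => by
    refine Eq.trans_le ?_ (Real.sqrt_le_sqrt (hGell x hx ξ).1)
    rw [Real.sqrt_mul hα.le, Real.sqrt_sq (norm_nonneg _)]
  set f : EuclideanSpace ℝ (Fin n) → ℝ :=
    fun x => φ x * √⟪G x (gradient u x), gradient u x⟫ with hf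
  set g : EuclideanSpace ℝ (Fin n) → ℝ :=
    fun x => |u x - c| * √⟪G x (gradient φ x), gradient φ x⟫ with hg
  have hf0 : ∀ x, 0 ≤ f x := fun x => mul_nonneg (hφ0 x) (Real.sqrt_nonneg _)
  have hg0 : ∀ x, 0 ≤ g x := fun x => by positivity
  have hfm : AEMeasurable f (volume.restrict K) := (hφm.mul hsm.sqrt).aemeasurable
  have hucm : AEMeasurable (fun x => |u x - c|) (volume.restrict K) := (hum.sub_const c).abs
  have hgm : AEMeasurable g (volume.restrict K) := hucm.mul htm.sqrt.aemeasurable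
  obtain ⟨M, hM⟩ := hKc.exists_bound_of_continuousOn (hφ.continuous.continuousOn.mul hgu.norm)
  obtain ⟨N, hN⟩ := hKc.exists_bound_of_continuousOn
    ((huK.sub continuousOn_const).abs.mul hgφ.norm (f := fun x => |u x - c|))
  have hN' : ∀ᵐ x ∂volume.restrict K, |u x - c| * ‖gradient φ x‖ ≤ N := by
    filter_upwards [ae_restrict_mem hKm] with x hx
    exact (le_abs_self _).trans (hN x hx)
  have hfM : ∀ᵐ x ∂volume.restrict K, f x ≤ √β * M := by
    filter_upwards [ae_restrict_mem hKm] with x hx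
    calc f x ≤ φ x * (√β * ‖gradient u x‖) :=
          mul_le_mul_of_nonneg_left (hle x (hφΩ hx) _) (hφ0 x)
      _ = √β * (φ x * ‖gradient u x‖) := by ring
      _ ≤ √β * M := by
          gcongr
          exact (le_abs_self _).trans (hM x hx)
  have hgle : ∀ᵐ x ∂volume.restrict K, g x ≤ √β * (|u x - c| * ‖gradient φ x‖) := by
    filter_upwards [ae_restrict_mem hKm] with x hx
    calc g x ≤ |u x - c| * (√β * ‖gradient φ x‖) :=
          mul_le_mul_of_nonneg_left (hle x (hφΩ hx) _) (abs_nonneg _)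
      _ = √β * (|u x - c| * ‖gradient φ x‖) := by ring
  have hgN : ∀ᵐ x ∂volume.restrict K, g x ≤ √β * N := by
    filter_upwards [hgle, hN'] with x hx hx'
    exact hx.trans (by gcongr)
  have hfle : ∀ᵐ x ∂volume.restrict K, φ x * ‖gradient u x‖ ≤ (√α)⁻¹ * f x := by
    filter_upwards [ae_restrict_mem hKm] with x hx
    have h := mul_le_mul_of_nonneg_left (hge x (hφΩ hx) (gradient u x)) (hφ0 x)
    rw [inv_mul_eq_div, le_div_iff₀ (Real.sqrt_pos.2 hα)]
    linarith
  set η : EuclideanSpace ℝ (Fin n) → ℝ := fun x => φ x ^ p * (u x - c) with hη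
  have hηsub : tsupport η ⊆ K := by
    refine closure_mono fun x hx hx0 => hx ?_
    simp [hη, hx0, Real.zero_rpow hp0.ne']
  have hηgrad : ∀ x ∈ Ω, gradient η x =
      φ x ^ p • gradient u x + (p * φ x ^ (p - 1) * (u x - c)) • gradient φ x := fun x hx =>
    gradient_rpow_mul_sub_const (hφ.differentiable one_ne_zero x)
      ((hu.contDiffAt (hΩ.mem_nhds hx)).differentiableAt one_ne_zero) hp1.le c
  have hharm := huharm η (hu.contDiff_rpow_mul_sub_const hΩ hφ hφΩ hp1.le c)
    (hKc.of_isClosed_subset (isClosed_tsupport η) hηsub) (hηsub.trans hφΩ)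
  rw [hrestrict _ fun x hx => by
    rw [hηgrad x hx.1, hφz x hx.2, hgz x hx.2, Real.zero_rpow hp0.ne']; simp] at hharm
  have hFm : Measurable fun x => ⟪G x (gradient u x), gradient u x⟫ ^ ((p - 2) / 2) *
      ⟪G x (gradient u x), gradient η x⟫ :=
    (hsm.pow_const _).mul ((Measurable.linearMap_family_apply hGmeas hmu).inner
      (measurable_gradient_s16 η))
  have hmain := integral_rpow_rpow_inv_le_of_abs_sub_le hp1 hfm hgm hFm.aemeasurable hf0 hg0
    hfM hgN hharm <| by
      filter_upwards [ae_restrict_mem hKm] with x hx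
      have hxΩ := hφΩ hx
      have hcs := LinearMap.abs_inner_le_sqrt_mul_sqrt (hGsymm x hxΩ) (hpos x hxΩ)
        (gradient u x) (gradient φ x)
      have hΓ := hpos x hxΩ (gradient u x)
      rw [hηgrad x hxΩ, inner_add_right, real_inner_smul_right, real_inner_smul_right]
      simp only [hf, hg]
      have hs0 := Real.sqrt_nonneg ⟪G x (gradient u x), gradient u x⟫
      set s := √⟪G x (gradient u x), gradient u x⟫ with hs
      set t := √⟪G x (gradient φ x), gradient φ x⟫
      have hss : ⟪G x (gradient u x), gradient u x⟫ = s ^ (2 : ℝ) := by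
        rw [Real.rpow_two, Real.sq_sqrt hΓ]
      rw [hss, ← Real.rpow_mul hs0, show 2 * ((p - 2) / 2) = p - 2 by ring]
      have hsp : s ^ (p - 2) * s ^ (2 : ℝ) = s ^ p := by
        rw [← Real.rpow_add_of_nonneg hs0 (by linarith) (by norm_num)]
        ring_nf
      have hsp1 : s ^ (p - 2) * s = s ^ (p - 1) := by
        nth_rw 2 [← Real.rpow_one s]
        rw [← Real.rpow_add_of_nonneg hs0 (by linarith) (by norm_num)]
        ring_nf
      rw [Real.mul_rpow (hφ0 x) hs0, Real.mul_rpow (hφ0 x) hs0, ← hsp, ← hsp1]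
      have hφp : 0 ≤ φ x ^ (p - 1) := Real.rpow_nonneg (hφ0 x) _
      have hsp2 : 0 ≤ s ^ (p - 2) := Real.rpow_nonneg hs0 _
      calc |s ^ (p - 2) * (φ x ^ p * s ^ (2 : ℝ) + p * φ x ^ (p - 1) * (u x - c) *
              ⟪G x (gradient u x), gradient φ x⟫) - φ x ^ p * (s ^ (p - 2) * s ^ (2 : ℝ))|
          = |(p * φ x ^ (p - 1) * s ^ (p - 2)) *
              ((u x - c) * ⟪G x (gradient u x), gradient φ x⟫)| := by ring_nf
        _ = (p * φ x ^ (p - 1) * s ^ (p - 2)) *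
              (|u x - c| * |⟪G x (gradient u x), gradient φ x⟫|) := by
            rw [abs_mul, abs_mul (u x - c), abs_of_nonneg (by positivity)]
        _ ≤ (p * φ x ^ (p - 1) * s ^ (p - 2)) * (|u x - c| * (s * t)) := by gcongr
        _ = p * (φ x ^ (p - 1) * (s ^ (p - 2) * s) * (|u x - c| * t)) := by ring
  have hleft : ∫ x in Ω, φ x ^ p * ‖gradient u x‖ ^ p =
      ∫ x in K, (φ x * ‖gradient u x‖) ^ p := by
    rw [hrestrict _ fun x hx => by simp [hφz x hx.2, Real.zero_rpow hp0.ne']]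
    simp only [Real.mul_rpow (hφ0 _) (norm_nonneg _)]
  have hright : ∫ x in Ω, ‖gradient φ x‖ ^ p * |u x - c| ^ p =
      ∫ x in K, (|u x - c| * ‖gradient φ x‖) ^ p := by
    rw [hrestrict _ fun x hx => by simp [hgz x hx.2, Real.zero_rpow hp0.ne']]
    simp only [Real.mul_rpow (abs_nonneg _) (norm_nonneg _), mul_comm]
  rw [hleft, hright]
  have h1 := integral_rpow_rpow_inv_le_mul hp0 (fun x => mul_nonneg (hφ0 x) (norm_nonneg _)) hf0
    hfm hfM (by positivity) hfle
  have h2 := integral_rpow_rpow_inv_le_mul hp0 hg0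
    (fun x => mul_nonneg (abs_nonneg (u x - c)) (norm_nonneg (gradient φ x)))
    (hucm.mul hmφ.norm.aemeasurable) hN' (Real.sqrt_nonneg β) hgle
  refine h1.trans ((mul_le_mul_of_nonneg_left (hmain.trans
    (mul_le_mul_of_nonneg_left h2 hp0.le)) (by positivity)).trans_eq ?_)
  rw [Real.sqrt_div hβ.le]
  ring
end
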